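/- Let δ ∈ (0, 1/2) satisfy 2(1−2δ)² > 1 and let R ≥ 0 and c ∈ ℂ with |c| > R / (2(1−2δ)² − 1). Then there exists no function f : ℂ → ℂ continuously differentiable (in the real sense) on an open neighborhood of the closed unit disc D with ∂̄f(z) = c for all |z| ≤ 1 − 2δ, |∂̄f(z)| ≤ |c| for all |z| ≤ 1, and |f(z)| ≤ R for all |z| = 1. -/

import Mathlib

/-- The anti-holomorphic derivative `∂̄f = (∂ₓf + i ∂_y f)/2` of a map `f : ℂ → ℂ`
(differentiable in the real sense). -/
noncomputable def dbar (f : ℂ → ℂ) (z : ℂ) : ℂ :=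
  (fderiv ℝ f z 1 + Complex.I * fderiv ℝ f z Complex.I) / 2

open Complex in
/-- The antiholomorphic part of a real-linear map, after precomposing with multiplication by `a`. -/
lemma I_mul_apply_sub_apply_mul_I (L : ℂ →L[ℝ] ℂ) (a : ℂ) :
    I * L a - L (a * I) = 2 * I * (starRingEnd ℂ a * ((L 1 + I * L I) / 2)) := by
  have key : ∀ x y : ℝ, L (x + y * I) = x * L 1 + y * L I := fun x y => by
    have : (x + y * I : ℂ) = x • (1 : ℂ) + y • I := by simp
    rw [this, map_add, map_smul, map_smul]
    simp
  have h1 : L a = a.re * L 1 + a.im * L I := by rw [← key, re_add_im]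
  have h2 : L (a * I) = (-a.im : ℝ) * L 1 + a.re * L I := by
    rw [← key]
    congr 1
    apply Complex.ext <;> simp
  have h3 : starRingEnd ℂ a = a.re - a.im * I := by
    apply Complex.ext <;> simp
  rw [h1, h2, h3]
  push_cast
  linear_combination (a.im * L 1 - a.re * L I + I * a.im * L I) * I_sq

open Complex Set Metric MeasureTheory in
/-- If `‖∂̄f‖ ≤ M` on the annulus `r ≤ ‖z‖ ≤ ρ`, then the integrals of `f` over the two bounding
circles differ by at most `2 * M` times the area of the annulus. -/
lemma norm_circleIntegral_sub_le_of_norm_dbar_le {f : ℂ → ℂ} {U : Set ℂ} {r ρ M : ℝ}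
    (hU : IsOpen U) (hf : ContDiffOn ℝ 1 f U) (h0 : 0 < r) (hle : r ≤ ρ)
    (hsub : closedBall 0 ρ \ ball 0 r ⊆ U)
    (hM : ∀ z ∈ closedBall 0 ρ \ ball 0 r, ‖dbar f z‖ ≤ M) :
    ‖(∮ z in C(0, ρ), f z) - ∮ z in C(0, r), f z‖ ≤ 2 * Real.pi * M * (ρ ^ 2 - r ^ 2) := by
  obtain ⟨a, rfl⟩ : ∃ a, Real.exp a = r := ⟨Real.log r, Real.exp_log h0⟩
  obtain ⟨b, rfl⟩ : ∃ b, Real.exp b = ρ := ⟨Real.log ρ, Real.exp_log (h0.trans_le hle)⟩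
  rw [Real.exp_le_exp] at hle
  set A : Set ℂ := closedBall 0 (Real.exp b) \ ball 0 (Real.exp a)
  set S : Set ℂ := uIcc a b ×ℂ uIcc 0 (2 * Real.pi)
  have h_maps : MapsTo exp S A := by
    rintro z ⟨h, -⟩
    simpa [A, norm_exp, hle] using h.symm
  set F : ℂ → ℂ := fun w => exp w * f (exp w)
  set G : ℂ → ℂ := fun w => 2 * I * (exp w * starRingEnd ℂ (exp w) * dbar f (exp w))
  have hfd : ∀ z ∈ U, DifferentiableAt ℝ f z := fun z hz =>
    (hf.differentiableOn one_ne_zero).differentiableAt (hU.mem_nhds hz)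
  have hfc : ContinuousOn (fderiv ℝ f) U := hf.continuousOn_fderiv_of_isOpen hU le_rfl
  have hFd : ∀ w ∈ S, DifferentiableAt ℝ F w := fun w hw => by
    have he : DifferentiableAt ℝ exp w := (differentiableAt_exp (𝕜 := ℂ)).restrictScalars ℝ
    exact he.mul ((hfd _ (hsub (h_maps hw))).comp w he)
  have hFG : ∀ w ∈ S, I • fderiv ℝ F w 1 - fderiv ℝ F w I = G w := fun w hw => by
    have he : HasFDerivAt exp _ w := (hasDerivAt_exp w).hasFDerivAt.restrictScalars ℝ
    have := he.mul ((hfd _ (hsub (h_maps hw))).hasFDerivAt.comp w he)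
    rw [HasFDerivAt.fderiv (f := F) this]
    have key := I_mul_apply_sub_apply_mul_I (fderiv ℝ f (exp w)) (exp w)
    simp only [G, dbar]
    simp [mul_comm I (exp w)]
    linear_combination exp w * key
  have hGc : ContinuousOn G S := by
    have hc : ContinuousOn (fun w => fderiv ℝ f (exp w)) S :=
      hfc.comp continuous_exp.continuousOn (h_maps.mono_right hsub)
    have h1 : ContinuousOn (fun w => fderiv ℝ f (exp w) 1) S := hc.clm_apply continuousOn_const
    have h2 : ContinuousOn (fun w => fderiv ℝ f (exp w) I) S := hc.clm_apply continuousOn_const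
    have h3 : Continuous fun w => starRingEnd ℂ (exp w) := continuous_conj.comp continuous_exp
    simp only [G, dbar]
    fun_prop
  have hScomp : IsCompact S := isCompact_uIcc.reProdIm isCompact_uIcc
  have hGn : ∀ w ∈ S, ‖G w‖ ≤ 2 * M * Real.exp (2 * w.re) := fun w hw => by
    simp only [G, norm_mul, norm_exp, RCLike.norm_conj, norm_I, two_mul w.re, Real.exp_add]
    have := hM _ (h_maps hw)
    have hp : 0 < Real.exp w.re * Real.exp w.re := by positivity
    norm_num
    nlinarith
  have stokes := integral_boundary_rect_of_differentiableOn_real F ⟨a, 0⟩ ⟨b, 2 * Real.pi⟩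
    (fun w hw => (hFd w hw).differentiableWithinAt)
    ((hGc.integrableOn_compact hScomp).congr_fun (fun w hw => (hFG w hw).symm)
      hScomp.measurableSet)
  have hL : ‖(∮ z in C(0, Real.exp b), f z) - ∮ z in C(0, Real.exp a), f z‖ =
      ‖∫ x : ℝ in a..b, ∫ y : ℝ in 0..2 * Real.pi,
        I • fderiv ℝ F (x + y * I) 1 - fderiv ℝ F (x + y * I) I‖ := by
    have htop : ∀ x : ℝ, F (x + (2 * Real.pi : ℝ) * I) = F (x + (0 : ℝ) * I) := fun x => by
      have : exp (x + 2 * Real.pi * I) = exp x := exp_periodic x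
      simp [F, this]
    have hcirc : ∀ t : ℝ, (∮ z in C(0, Real.exp t), f z) =
        I • ∫ y : ℝ in 0..2 * Real.pi, F (t + y * I) := fun t => by
      rw [circleIntegral, ← intervalIntegral.integral_smul]
      refine intervalIntegral.integral_congr fun y _ => ?_
      simp only [F, deriv_circleMap, circleMap, exp_add, smul_eq_mul, ofReal_exp, zero_add]
      ring
    simp only [htop, sub_self, zero_add] at stokes
    rw [← stokes, hcirc, hcirc]
  rw [hL]
  have hint : ∫ x in a..b, 2 * M * Real.exp (2 * x) * (2 * Real.pi) =
      2 * Real.pi * M * (Real.exp b ^ 2 - Real.exp a ^ 2) := by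
    rw [intervalIntegral.integral_mul_const, intervalIntegral.integral_const_mul,
      intervalIntegral.integral_comp_mul_left _ two_ne_zero, integral_exp, two_mul b, two_mul a,
      Real.exp_add, Real.exp_add, smul_eq_mul]
    ring
  rw [← hint]
  refine intervalIntegral.norm_integral_le_of_norm_le hle (.of_forall fun x hx => ?_)
    (Continuous.intervalIntegrable (by fun_prop) _ _)
  refine (intervalIntegral.norm_integral_le_of_norm_le_const
    (C := 2 * M * Real.exp (2 * x)) fun y hy => ?_).trans_eq ?_
  · have hmem : (x + y * I : ℂ) ∈ S := by
      refine ⟨?_, ?_⟩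
      · simpa [uIcc_of_le hle] using ⟨hx.1.le, hx.2⟩
      · simpa using uIoc_subset_uIcc hy
    rw [hFG _ hmem]
    simpa using hGn _ hmem
  · rw [sub_zero, abs_of_pos Real.two_pi_pos]

open Complex Metric in
/-- If `∂̄f = c` on a closed disc of radius `r` centred at the origin, then the integral of `f` over
the boundary circle is `2 * I * c` times the area of the disc. -/
lemma circleIntegral_eq_of_dbar_eq_const {f : ℂ → ℂ} {r : ℝ} {c : ℂ} (h0 : 0 < r)
    (hf : ∀ z ∈ closedBall 0 r, DifferentiableAt ℝ f z)
    (hc : ∀ z ∈ closedBall 0 r, dbar f z = c) :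
    (∮ z in C(0, r), f z) = 2 * Real.pi * I * (c * r ^ 2) := by
  have hconj : ∀ z, HasFDerivAt (fun z => c * starRingEnd ℂ z)
      (c • (conjCLE : ℂ →L[ℝ] ℂ)) z := fun z => conjCLE.hasFDerivAt.const_mul c
  have hd : ∀ z ∈ closedBall 0 r,
      DifferentiableAt ℂ (fun z => f z - c * starRingEnd ℂ z) z := fun z hz => by
    have := (hf z hz).hasFDerivAt.sub (hconj z)
    refine differentiableAt_complex_iff_differentiableAt_real.2 ⟨this.differentiableAt, ?_⟩
    rw [HasFDerivAt.fderiv (f := fun z => f z - c * starRingEnd ℂ z) this]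
    have key := hc z hz
    simp only [dbar] at key
    simp
    linear_combination (-2 * I) * key + fderiv ℝ f z I * I_sq
  have hg := circleIntegral_eq_zero_of_differentiable_on_off_countable h0.le Set.countable_empty
    (fun z hz => (hd z hz).continuousAt.continuousWithinAt)
    (fun z hz => hd z (ball_subset_closedBall hz.1))
  have hfi : CircleIntegrable f 0 r := ContinuousOn.circleIntegrable h0.le
    fun z hz => (hf z (sphere_subset_closedBall hz)).continuousAt.continuousWithinAt
  have hci : CircleIntegrable (fun z => c * starRingEnd ℂ z) 0 r :=
    ContinuousOn.circleIntegrable h0.le fun z _ => (hconj z).continuousAt.continuousWithinAt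
  rw [circleIntegral.integral_sub hfi hci, sub_eq_zero] at hg
  rw [hg]
  calc (∮ z in C(0, r), c * starRingEnd ℂ z) = ∮ z in C(0, r), (c * r ^ 2) * (z - 0)⁻¹ := by
        refine circleIntegral.integral_congr h0.le fun z hz => ?_
        have hz' : ‖z‖ = r := by simpa using hz
        have hz0 : z ≠ 0 := norm_pos_iff.1 (hz' ▸ h0)
        have := mul_conj' z
        rw [hz'] at this
        simp only [sub_zero]
        field_simp
        linear_combination c * this
    _ = _ := by
        rw [circleIntegral.integral_const_mul, circleIntegral.integral_sub_center_inv _ h0.ne']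
        ring

/-- Proposition 4.1: for `|c| > R / (2(1-2δ)² - 1)` there is no `f : ℂ → ℂ`, continuously
differentiable in the real sense on a neighborhood of the closed unit disc, with
`∂̄f = c` on the disc of radius `1 - 2δ`, `|∂̄f| ≤ |c|` on the closed unit disc, and
`|f| ≤ R` on the unit circle. -/
theorem no_solution_of_large_c (δ : ℝ) (hδ0 : 0 < δ) (hδ1 : δ < 1 / 2)
    (h2 : 1 < 2 * (1 - 2 * δ) ^ 2) (R : ℝ) (hR : 0 ≤ R) (c : ℂ)
    (hc : R / (2 * (1 - 2 * δ) ^ 2 - 1) < ‖c‖) :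
    ¬ ∃ (f : ℂ → ℂ) (U : Set ℂ), IsOpen U ∧ Metric.closedBall (0 : ℂ) 1 ⊆ U ∧
      ContDiffOn ℝ 1 f U ∧
      (∀ z : ℂ, ‖z‖ ≤ 1 - 2 * δ → dbar f z = c) ∧
      (∀ z : ℂ, ‖z‖ ≤ 1 → ‖dbar f z‖ ≤ ‖c‖) ∧
      (∀ z : ℂ, ‖z‖ = 1 → ‖f z‖ ≤ R) := by
  rintro ⟨f, U, hU, hsub, hf, hconst, hle, hbd⟩
  set r := 1 - 2 * δ with hr
  have hr0 : 0 < r := by linarith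
  have hr1 : r ≤ 1 := by linarith
  have h1 := norm_circleIntegral_sub_le_of_norm_dbar_le hU hf hr0 hr1
    (Set.sdiff_subset.trans hsub) fun z hz => hle z (by simpa using hz.1)
  have h3 := circleIntegral.norm_integral_le_of_norm_le_const zero_le_one
    fun z (hz : z ∈ Metric.sphere (0 : ℂ) 1) => hbd z (by simpa using hz)
  have h4 := circleIntegral_eq_of_dbar_eq_const hr0
    (fun z hz => (hf.differentiableOn one_ne_zero).differentiableAt
      (hU.mem_nhds (hsub (Metric.closedBall_subset_closedBall hr1 hz))))
    fun z hz => hconst z (by simpa using hz)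
  have h5 : ‖∮ z in C(0, r), f z‖ = 2 * Real.pi * (‖c‖ * r ^ 2) := by
    rw [h4]
    simp [abs_of_pos Real.pi_pos]
  have h6 := norm_sub_norm_le (∮ z in C(0, r), f z) (∮ z in C(0, 1), f z)
  rw [norm_sub_rev] at h6
  rw [div_lt_iff₀ (by linarith)] at hc
  have h7 : 2 * Real.pi * R < 2 * Real.pi * (‖c‖ * (2 * r ^ 2 - 1)) :=
    mul_lt_mul_of_pos_left hc Real.two_pi_pos
  linarith
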